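/- Let 𝒫 = conv{P_1,…,P_m} be a finitely generated credal set of probability measures on Z, let P, Q ∈ 𝒫 with d_TV(P,Q) ≤ η for some η > 0, let H be a finite nonempty hypothesis class with measurable error sets, let ĥ be an empirical risk minimizer on samples of size n ≥ 1 drawn i.i.d. from P, and let h* ∈ H minimize L_P over H. Then for every δ ∈ (0,1), P^{⊗n}({s ∈ Z^n : L_Q(ĥ(s)) − L_P(h*) ≤ 4·sup_{Q'∈𝒫} R_{n,Q'}(H) + √(2 log(2/δ)/n) + η}) ≥ 1 − δ. -/

import Mathlib

open MeasureTheory Finset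
open scoped ENNReal NNReal Classical

variable {X Y : Type*}

/-- The error set of hypothesis `h : X → Y`. -/
def errSet (h : X → Y) : Set (X × Y) := {p | p.2 ≠ h p.1}

variable [MeasurableSpace X] [MeasurableSpace Y]

/-- Expected risk of `h` under `P` with the zero-one loss: `L_P(h) = P(A_h)`. -/
noncomputable def risk (P : Measure (X × Y)) (h : X → Y) : ℝ := (P (errSet h)).toReal

/-- Empirical risk of `h` on the sample `s` of size `n`. -/
noncomputable def empRisk {n : ℕ} (s : Fin n → X × Y) (h : X → Y) : ℝ :=
  ((Finset.univ.filter fun i => (s i).2 ≠ h (s i).1).card : ℝ) / n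

/-- `A` is an empirical risk minimizer over the hypothesis class `H`. -/
def IsERM {n : ℕ} (H : Finset (X → Y)) (A : (Fin n → X × Y) → (X → Y)) : Prop :=
  ∀ s, A s ∈ H ∧ ∀ h ∈ H, empRisk s (A s) ≤ empRisk s h

/-- Measurability of a hypothesis-valued map (sufficient notion since `H` is finite). -/
def MeasurableERM {n : ℕ} (A : (Fin n → X × Y) → (X → Y)) : Prop :=
  ∀ h : X → Y, MeasurableSet {s | A s = h}

/-- Membership in the finitely generated credal set `conv{P_1, …, P_m}`. -/
def memCredal {Z : Type*} [MeasurableSpace Z] {m : ℕ} (Pm : Fin m → Measure Z)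
    (P : Measure Z) : Prop :=
  ∃ w : Fin m → ℝ≥0, (∑ j, w j = 1) ∧ P = ∑ j, (w j : ℝ≥0∞) • Pm j

/-- Total variation distance between measures. -/
noncomputable def dTV {Z : Type*} [MeasurableSpace Z] (P Q : Measure Z) : ℝ :=
  ⨆ A : {A : Set Z // MeasurableSet A}, |(P A.1).toReal - (Q A.1).toReal|

/-- Rademacher complexity of the zero-one loss class of `H` at sample size `n` under `P`. -/
noncomputable def rademacher (n : ℕ) (P : Measure (X × Y)) (H : Finset (X → Y)) : ℝ :=
  ∫ p : (Fin n → X × Y) × (Fin n → Bool),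
    (⨆ h : H, (∑ i, (if p.2 i then (1 : ℝ) else -1) *
      (if (p.1 i).2 ≠ (h : X → Y) (p.1 i).1 then 1 else 0)) / n)
    ∂((Measure.pi fun _ => P).prod (Measure.pi fun _ => (PMF.uniformOfFintype Bool).toMeasure))

theorem integral_pi_eq_integral_integral_cons {Z : Type*} [MeasurableSpace Z] (P : Measure Z)
    [IsProbabilityMeasure P] {n : ℕ} {f : (Fin (n + 1) → Z) → ℝ}
    (hf : Integrable f (Measure.pi fun _ => P)) :
    ∫ s, f s ∂(Measure.pi fun _ => P)
      = ∫ z, ∫ s, f (Fin.cons z s) ∂(Measure.pi fun _ : Fin n => P) ∂P := by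
  have h := (measurePreserving_piFinSuccAbove (fun _ : Fin (n + 1) => P) 0).symm
  have hi := (h.integrable_comp_emb (MeasurableEquiv.measurableEmbedding _)).2 hf
  rw [← h.integral_comp']
  refine (integral_prod _ hi).trans ?_
  simp [MeasurableEquiv.piFinSuccAbove_symm_apply, Fin.insertNthEquiv]

theorem integrable_of_measurable_of_abs_le {Ω : Type*} [MeasurableSpace Ω] {μ : Measure Ω}
    [IsFiniteMeasure μ] {f : Ω → ℝ} {B : ℝ} (hf : Measurable f) (hB : ∀ x, |f x| ≤ B) :
    Integrable f μ :=
  .of_bound hf.aestronglyMeasurable B (ae_of_all _ hB)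

theorem abs_integral_le_of_abs_le {Ω : Type*} [MeasurableSpace Ω] {μ : Measure Ω}
    [IsProbabilityMeasure μ] {f : Ω → ℝ} {B : ℝ} (hB : ∀ x, |f x| ≤ B) : |∫ x, f x ∂μ| ≤ B := by
  simpa using norm_integral_le_of_norm_le_const (μ := μ) (f := f) (C := B) (ae_of_all _ hB)

/-- **McDiarmid's inequality**, as a bound on the moment generating function. -/
theorem hasSubgaussianMGF_pi_of_update_sub_le {Z : Type*} [MeasurableSpace Z] (P : Measure Z)
    [IsProbabilityMeasure P] (c : ℝ≥0) {n : ℕ} (f : (Fin n → Z) → ℝ) (hf : Measurable f)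
    (B : ℝ) (hB : ∀ s, |f s| ≤ B) (hc : ∀ s i z, f (Function.update s i z) - f s ≤ c) :
    ProbabilityTheory.HasSubgaussianMGF (fun s => f s - ∫ x, f x ∂(Measure.pi fun _ => P))
      (n * (c / 2) ^ 2) (Measure.pi fun _ => P) := by
  induction n with
  | zero =>
    have hconst : f = fun _ => f finZeroElim := by
      funext s; congr 1; exact Subsingleton.elim _ _
    rw [hconst]
    simp
  | succ n ih =>
    have hcons : Measurable fun p : Z × (Fin n → Z) => f (Fin.cons p.1 p.2) :=
      hf.comp (measurable_pi_iff.2 (Fin.cases (by simpa using measurable_fst)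
        fun i => by simpa [Function.comp_def] using (measurable_pi_apply i).comp measurable_snd))
    have hconsz (z : Z) : Measurable fun s : Fin n → Z => f (Fin.cons z s) :=
      hcons.comp measurable_prodMk_left
    have hfi := integrable_of_measurable_of_abs_le (μ := Measure.pi fun _ => P) hf hB
    set E := ∫ x, f x ∂(Measure.pi fun _ => P) with hE
    set g : Z → ℝ := fun z => ∫ s, f (Fin.cons z s) ∂(Measure.pi fun _ : Fin n => P) with hg
    have hgm : Measurable g := hcons.stronglyMeasurable.integral_prod_right.measurable
    have hEg : E = ∫ z, g z ∂P := integral_pi_eq_integral_integral_cons P hfi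
    have hgB (z : Z) : |g z| ≤ B := abs_integral_le_of_abs_le fun s => hB _
    have hgc (z w : Z) : g z ≤ g w + c := by
      have : g z ≤ ∫ s, (f (Fin.cons w s) + c) ∂(Measure.pi fun _ : Fin n => P) := by
        refine integral_mono (integrable_of_measurable_of_abs_le (hconsz z) fun s => hB _)
          ((integrable_of_measurable_of_abs_le (hconsz w) fun s => hB _).add
            (integrable_const _)) fun s => ?_
        have := hc (Fin.cons w s) 0 z
        rw [Fin.update_cons_zero] at this
        dsimp only
        linarith
      rwa [integral_add (integrable_of_measurable_of_abs_le (hconsz w) fun s => hB _)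
        (integrable_const _), integral_const, probReal_univ, one_smul] at this
    have hsub : ProbabilityTheory.HasSubgaussianMGF (fun z => g z - E) ((c / 2) ^ 2) P := by
      have hbdd : BddBelow (Set.range g) :=
        ⟨-B, by rintro _ ⟨z, rfl⟩; exact (abs_le.1 (hgB z)).1⟩
      have := nonempty_of_isProbabilityMeasure P
      have := ProbabilityTheory.hasSubgaussianMGF_of_mem_Icc (μ := P) (a := ⨅ z, g z)
        (b := (⨅ z, g z) + c) hgm.aemeasurable (ae_of_all _ fun z => ⟨ciInf_le hbdd z, by
          rw [← sub_le_iff_le_add]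
          exact le_ciInf fun w => by linarith [hgc z w]⟩)
      rw [hEg]
      simpa using this
    have hint (t : ℝ) : Integrable (fun s => Real.exp (t * (f s - E)))
        (Measure.pi fun _ => P) :=
      ProbabilityTheory.integrable_exp_mul_of_mem_Icc (a := -B - E) (b := B - E)
        (hf.sub_const _).aemeasurable (ae_of_all _ fun s =>
          ⟨by linarith [(abs_le.1 (hB s)).1], by linarith [(abs_le.1 (hB s)).2]⟩)
    refine ⟨hint, fun t => ?_⟩
    rw [ProbabilityTheory.mgf, integral_pi_eq_integral_integral_cons P (hint t)]
    have hz (z : Z) : ∫ s, Real.exp (t * (f (Fin.cons z s) - E)) ∂(Measure.pi fun _ : Fin n => P)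
        ≤ Real.exp (t * (g z - E)) * Real.exp ((n * (c / 2) ^ 2 : ℝ≥0) * t ^ 2 / 2) := by
      have h := (ih (fun s => f (Fin.cons z s)) (hconsz z) (fun s => hB _) fun s i w => by
        have := hc (Fin.cons z s) i.succ w
        rwa [← Fin.cons_update] at this).mgf_le t
      calc _ = ∫ s, Real.exp (t * (g z - E)) * Real.exp (t * (f (Fin.cons z s) - g z))
            ∂(Measure.pi fun _ : Fin n => P) := by
            refine integral_congr_ae (ae_of_all _ fun s => ?_)
            dsimp only
            rw [← Real.exp_add]
            ring_nf
        _ ≤ _ := by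
            rw [integral_const_mul]
            exact mul_le_mul_of_nonneg_left h (Real.exp_pos _).le
    calc _ ≤ ∫ z, Real.exp (t * (g z - E)) * Real.exp ((n * (c / 2) ^ 2 : ℝ≥0) * t ^ 2 / 2) ∂P :=
          integral_mono_of_nonneg (ae_of_all _ fun z => integral_nonneg fun s => (Real.exp_pos _).le)
            ((hsub.integrable_exp_mul t).mul_const _) (ae_of_all _ hz)
      _ ≤ Real.exp (((c / 2) ^ 2 : ℝ≥0) * t ^ 2 / 2)
            * Real.exp ((n * (c / 2) ^ 2 : ℝ≥0) * t ^ 2 / 2) := by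
          rw [integral_mul_const]
          exact mul_le_mul_of_nonneg_right (hsub.mgf_le t) (Real.exp_pos _).le
      _ = _ := by
          rw [← Real.exp_add]
          push_cast
          ring_nf

theorem abs_iSup_le_of_abs_le {ι : Type*} [Nonempty ι] {u : ι → ℝ} {B : ℝ}
    (h : ∀ i, |u i| ≤ B) : |⨆ i, u i| ≤ B := by
  have hbdd : BddAbove (Set.range u) := ⟨B, by rintro _ ⟨i, rfl⟩; exact (abs_le.1 (h i)).2⟩
  obtain ⟨i⟩ := ‹Nonempty ι›
  exact abs_le.2 ⟨(abs_le.1 (h i)).1.trans (le_ciSup hbdd i),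
    have : Nonempty ι := ⟨i⟩; ciSup_le fun j => (abs_le.1 (h j)).2⟩

theorem abs_sum_div_le_one {n : ℕ} {u : Fin n → ℝ} (h : ∀ i, |u i| ≤ 1) :
    |(∑ i, u i) / n| ≤ 1 := by
  rw [abs_div, Nat.abs_cast]
  refine div_le_one_of_le₀ ((Finset.abs_sum_le_sum_abs _ _).trans ?_) n.cast_nonneg
  simpa using Finset.sum_le_card_nsmul Finset.univ (fun i => |u i|) 1 fun i _ => h i

theorem measurePreserving_ite_swap {Z : Type*} [MeasurableSpace Z] (P : Measure Z)
    [IsProbabilityMeasure P] {n : ℕ} (σ : Fin n → Bool) :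
    MeasurePreserving
      (fun p : (Fin n → Z) × (Fin n → Z) =>
        (fun i => if σ i then p.1 i else p.2 i, fun i => if σ i then p.2 i else p.1 i))
      ((Measure.pi fun _ => P).prod (Measure.pi fun _ => P))
      ((Measure.pi fun _ => P).prod (Measure.pi fun _ => P)) := by
  have h := measurePreserving_arrowProdEquivProdArrow Z Z (Fin n) (fun _ => P) (fun _ => P)
  have hσ : MeasurePreserving (fun (a : Fin n → Z × Z) i => (if σ i then id else Prod.swap) (a i))
      (Measure.pi fun _ => P.prod P) (Measure.pi fun _ => P.prod P) := by
    refine measurePreserving_pi (fun _ => P.prod P) (fun _ => P.prod P) fun i => ?_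
    split_ifs
    · exact .id _
    · exact Measure.measurePreserving_swap
  convert h.comp (hσ.comp h.symm) using 1
  funext p
  ext i <;> cases hi : σ i <;>
    simp [MeasurableEquiv.arrowProdEquivProdArrow, Equiv.arrowProdEquivProdArrow, hi]

section Symmetrization

variable {Z ι : Type*} [MeasurableSpace Z] [Fintype ι] [Nonempty ι]

/-- The supremum over a family of losses of the empirical average with signs `σ`. -/
noncomputable def signedSup {n : ℕ} (ℓ : ι → Z → ℝ) (s : Fin n → Z) (σ : Fin n → Bool) : ℝ :=
  ⨆ h, (∑ i, (if σ i then (1 : ℝ) else -1) * ℓ h (s i)) / n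

theorem abs_signedSup_le {Z ι : Type*} [Nonempty ι] {ℓ : ι → Z → ℝ} (hb : ∀ h z, |ℓ h z| ≤ 1)
    {n : ℕ} (s : Fin n → Z) (σ : Fin n → Bool) : |signedSup ℓ s σ| ≤ 1 :=
  abs_iSup_le_of_abs_le fun h => abs_sum_div_le_one fun i => by
    split_ifs <;> simpa using hb h (s i)

theorem measurable_signedSup {Z ι : Type*} [MeasurableSpace Z] [Countable ι]
    {ℓ : ι → Z → ℝ} (hm : ∀ h, Measurable (ℓ h)) {n : ℕ} :
    Measurable fun p : (Fin n → Z) × (Fin n → Bool) => signedSup ℓ p.1 p.2 := by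
  refine Measurable.iSup fun h => Measurable.div_const (Finset.measurable_sum _ fun i _ => ?_) _
  have h1 : Measurable fun b : Bool => if b then (1 : ℝ) else -1 := measurable_of_countable _
  exact (h1.comp ((measurable_pi_apply i).comp measurable_snd)).mul
    ((hm h).comp ((measurable_pi_apply i).comp measurable_fst))

theorem integrable_signedSup {ℓ : ι → Z → ℝ} (hm : ∀ h, Measurable (ℓ h))
    (hb : ∀ h z, |ℓ h z| ≤ 1) {n : ℕ} (σ : Fin n → Bool) {μ : Measure (Fin n → Z)}
    [IsFiniteMeasure μ] : Integrable (fun s => signedSup ℓ s σ) μ :=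
  integrable_of_measurable_of_abs_le (f := fun s => signedSup ℓ s σ)
    ((measurable_signedSup hm).comp (f := fun s => (s, σ)) measurable_prodMk_right)
    fun s => abs_signedSup_le hb s σ

theorem integral_sum_div {ℓ : Z → ℝ} (P : Measure Z) [IsProbabilityMeasure P]
    (hm : Measurable ℓ) (hb : ∀ z, |ℓ z| ≤ 1) {n : ℕ} (hn : n ≠ 0) :
    ∫ s, (∑ i, ℓ (s i)) / n ∂(Measure.pi fun _ : Fin n => P) = ∫ z, ℓ z ∂P := by
  rw [integral_div, integral_finsetSum _ fun i _ => integrable_of_measurable_of_abs_le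
    (f := fun s : Fin n → Z => ℓ (s i)) (hm.comp (measurable_pi_apply i)) fun s => hb _]
  simp_rw [integral_comp_eval (μ := fun _ : Fin n => P) hm.aestronglyMeasurable]
  have : (n : ℝ) ≠ 0 := by exact_mod_cast hn
  simp
  field_simp

theorem integral_iSup_sub_le_signedSup (P : Measure Z) [IsProbabilityMeasure P] {ℓ : ι → Z → ℝ}
    (hm : ∀ h, Measurable (ℓ h)) (hb : ∀ h z, |ℓ h z| ≤ 1) {n : ℕ} (hn : n ≠ 0)
    (σ : Fin n → Bool) :
    ∫ s, ⨆ h, (∫ z, ℓ h z ∂P - (∑ i, ℓ h (s i)) / n) ∂(Measure.pi fun _ : Fin n => P)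
      ≤ ∫ s, signedSup ℓ s σ ∂(Measure.pi fun _ : Fin n => P)
        + ∫ s, signedSup ℓ s (fun i => !σ i) ∂(Measure.pi fun _ : Fin n => P) := by
  set μ := Measure.pi fun _ : Fin n => P with hμ
  have hbdd (u : ι → ℝ) : BddAbove (Set.range u) := (Set.finite_range u).bddAbove
  let avg (h : ι) (s : Fin n → Z) : ℝ := (∑ i, ℓ h (s i)) / n
  have havgm (h : ι) : Measurable (avg h) :=
    (Finset.measurable_sum _ fun i _ => (hm h).comp (measurable_pi_apply i)).div_const _
  have havgb (h : ι) (s) : |avg h s| ≤ 1 := abs_sum_div_le_one fun i => hb h (s i)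
  let G (p : (Fin n → Z) × (Fin n → Z)) : ℝ := ⨆ h, (avg h p.1 - avg h p.2)
  have hGm : Measurable G := .iSup fun h =>
    ((havgm h).comp measurable_fst).sub ((havgm h).comp measurable_snd)
  have hdiffb (h : ι) (s s') : |avg h s - avg h s'| ≤ 2 := by
    linarith [abs_sub (avg h s) (avg h s'), havgb h s, havgb h s']
  have hGb (p) : |G p| ≤ 2 := abs_iSup_le_of_abs_le fun h => hdiffb h _ _
  have hGi : Integrable G (μ.prod μ) := integrable_of_measurable_of_abs_le hGm hGb
  have hT := measurePreserving_ite_swap P σ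
  calc ∫ s, ⨆ h, (∫ z, ℓ h z ∂P - avg h s) ∂μ
      ≤ ∫ s, ∫ s', G (s', s) ∂μ ∂μ := by
        refine integral_mono (integrable_of_measurable_of_abs_le (B := 2)
          (.iSup fun h => (havgm h).const_sub _) fun s => abs_iSup_le_of_abs_le fun h => ?_)
          hGi.swap.integral_prod_left fun s => ciSup_le fun h => ?_
        · linarith [abs_sub (∫ z, ℓ h z ∂P) (avg h s), havgb h s,
            abs_integral_le_of_abs_le (μ := P) (hb h)]
        · rw [← integral_sum_div P (hm h) (hb h) hn]
          have hi : Integrable (avg h) μ :=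
            integrable_of_measurable_of_abs_le (havgm h) (havgb h)
          calc ∫ s', avg h s' ∂μ - avg h s = ∫ s', (avg h s' - avg h s) ∂μ := by
                rw [integral_sub hi (integrable_const _)]; simp
            _ ≤ _ := integral_mono (hi.sub (integrable_const _))
                (integrable_of_measurable_of_abs_le (hGm.comp measurable_prodMk_right)
                  fun s' => hGb _) fun s' => le_ciSup (hbdd fun h => avg h s' - avg h s) h
    _ = ∫ p, G p ∂(μ.prod μ) := (integral_prod_symm G hGi).symm
    _ = ∫ p, G (fun i => if σ i then p.1 i else p.2 i, fun i => if σ i then p.2 i else p.1 i)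
          ∂(μ.prod μ) := by
        conv_lhs => rw [← hT.map_eq]
        exact integral_map hT.measurable.aemeasurable (by
          rw [hT.map_eq]; exact hGm.aestronglyMeasurable)
    _ ≤ ∫ p, (signedSup ℓ p.1 σ + signedSup ℓ p.2 fun i => !σ i) ∂(μ.prod μ) := by
        refine integral_mono (hT.integrable_comp_of_integrable hGi)
          (((integrable_signedSup hm hb σ).comp_fst μ).add
            ((integrable_signedSup hm hb _).comp_snd μ)) fun p => ciSup_le fun h => ?_
        refine le_trans (le_of_eq ?_) (add_le_add
          (le_ciSup (hbdd fun h => (∑ i, (if σ i then (1 : ℝ) else -1) * ℓ h (p.1 i)) / n) h)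
          (le_ciSup (hbdd fun h => (∑ i, (if !σ i then (1 : ℝ) else -1) * ℓ h (p.2 i)) / n) h))
        simp only [avg]
        rw [← sub_div, ← add_div, ← Finset.sum_sub_distrib, ← Finset.sum_add_distrib]
        congr 1
        refine Finset.sum_congr rfl fun i _ => ?_
        cases σ i <;> simp <;> ring
    _ = _ := by
        rw [integral_add ((integrable_signedSup hm hb σ).comp_fst μ)
          ((integrable_signedSup hm hb _).comp_snd μ),
          integral_fun_fst fun s => signedSup ℓ s σ,
          integral_fun_snd fun s => signedSup ℓ s fun i => !σ i]
        simp

/-- **Symmetrization**: the expected uniform deviation is at most twice the expected supremum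
of the averages weighted by random signs. -/
theorem integral_iSup_sub_le_two_mul (P : Measure Z) [IsProbabilityMeasure P] {ℓ : ι → Z → ℝ}
    (hm : ∀ h, Measurable (ℓ h)) (hb : ∀ h z, |ℓ h z| ≤ 1) {n : ℕ} (hn : n ≠ 0) :
    ∫ s, ⨆ h, (∫ z, ℓ h z ∂P - (∑ i, ℓ h (s i)) / n) ∂(Measure.pi fun _ : Fin n => P)
      ≤ 2 * ∫ p : (Fin n → Z) × (Fin n → Bool), signedSup ℓ p.1 p.2
        ∂((Measure.pi fun _ => P).prod
          (Measure.pi fun _ => (PMF.uniformOfFintype Bool).toMeasure)) := by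
  set μ := Measure.pi fun _ : Fin n => P
  set ν := Measure.pi fun _ : Fin n => (PMF.uniformOfFintype Bool).toMeasure with hν
  have hi : Integrable (fun p : (Fin n → Z) × (Fin n → Bool) => signedSup ℓ p.1 p.2)
      (μ.prod ν) :=
    integrable_of_measurable_of_abs_le (measurable_signedSup hm) fun p => abs_signedSup_le hb _ _
  have hnot : MeasurePreserving (fun (σ : Fin n → Bool) i => !σ i) ν ν := by
    refine measurePreserving_pi _ _ fun _ => ⟨measurable_of_countable _, ?_⟩
    refine Measure.ext_of_singleton fun b => ?_
    rw [Measure.map_apply (measurable_of_countable _) (measurableSet_singleton b)]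
    have : (fun a : Bool => !a) ⁻¹' {b} = {!b} := by ext a; cases a <;> cases b <;> simp
    simp [this]
  set r : (Fin n → Bool) → ℝ := fun σ => ∫ s, signedSup ℓ s σ ∂μ with hr
  have hri : Integrable r ν := hi.integral_prod_right
  have hrn : Integrable (fun σ => r fun i => !σ i) ν := hnot.integrable_comp_of_integrable hri
  have hrn_eq : ∫ σ, r (fun i => !σ i) ∂ν = ∫ σ, r σ ∂ν := by
    conv_rhs => rw [← hnot.map_eq]
    exact (integral_map hnot.measurable.aemeasurable
      (measurable_of_countable _).aestronglyMeasurable).symm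
  calc _ = ∫ _σ, (∫ s, ⨆ h, (∫ z, ℓ h z ∂P - (∑ i, ℓ h (s i)) / n) ∂μ) ∂ν := by simp
    _ ≤ ∫ σ, (r σ + r fun i => !σ i) ∂ν := integral_mono (integrable_const _) (hri.add hrn)
        fun σ => integral_iSup_sub_le_signedSup P hm hb hn σ
    _ = 2 * ∫ p, signedSup ℓ p.1 p.2 ∂(μ.prod ν) := by
        rw [integral_add hri hrn, hrn_eq, integral_prod_symm _ hi, two_mul]

theorem integral_iSup_sub_nonneg (P : Measure Z) [IsProbabilityMeasure P] {ℓ : ι → Z → ℝ}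
    (hm : ∀ h, Measurable (ℓ h)) (hb : ∀ h z, |ℓ h z| ≤ 1) {n : ℕ} (hn : n ≠ 0) :
    0 ≤ ∫ s, ⨆ h, (∫ z, ℓ h z ∂P - (∑ i, ℓ h (s i)) / n) ∂(Measure.pi fun _ : Fin n => P) := by
  obtain ⟨h₀⟩ := ‹Nonempty ι›
  have : Nonempty ι := ⟨h₀⟩
  have havgm (h : ι) : Measurable fun s : Fin n → Z => (∑ i, ℓ h (s i)) / n :=
    (Finset.measurable_sum _ fun i _ => (hm h).comp (measurable_pi_apply i)).div_const _
  have havgi : Integrable (fun s : Fin n → Z => (∑ i, ℓ h₀ (s i)) / n)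
      (Measure.pi fun _ => P) :=
    integrable_of_measurable_of_abs_le (havgm h₀) fun s => abs_sum_div_le_one fun i => hb h₀ _
  calc (0 : ℝ) = ∫ s, (∫ z, ℓ h₀ z ∂P - (∑ i, ℓ h₀ (s i)) / n)
        ∂(Measure.pi fun _ : Fin n => P) := by
        rw [integral_sub (integrable_const _) havgi, integral_sum_div P (hm h₀) (hb h₀) hn]
        simp
    _ ≤ _ := by
        refine integral_mono ((integrable_const _).sub havgi)
          (integrable_of_measurable_of_abs_le (B := 2) (.iSup fun h => (havgm h).const_sub _)
            fun s => abs_iSup_le_of_abs_le fun h => ?_)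
          fun s => le_ciSup (f := fun h => ∫ z, ℓ h z ∂P - (∑ i, ℓ h (s i)) / n)
            (Set.finite_range _).bddAbove h₀
        have := abs_sum_div_le_one fun i => hb h (s i)
        linarith [abs_sub (∫ z, ℓ h z ∂P) ((∑ i, ℓ h (s i)) / n),
          abs_integral_le_of_abs_le (μ := P) (hb h)]

theorem abs_sum_update_div_sub_le {Z : Type*} {ℓ : Z → ℝ} (hb : ∀ z, ℓ z ∈ Set.Icc (0 : ℝ) 1) {n : ℕ}
    (s : Fin n → Z) (i : Fin n) (z : Z) :
    |(∑ j, ℓ (Function.update s i z j)) / n - (∑ j, ℓ (s j)) / n| ≤ 1 / n := by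
  rw [← sub_div, ← Finset.sum_sub_distrib, Finset.sum_eq_single i
    (fun j _ hj => by simp [hj]) (fun h => absurd (Finset.mem_univ i) h), abs_div, Nat.abs_cast,
    Function.update_self]
  gcongr
  exact abs_le.2 ⟨by linarith [(hb z).1, (hb (s i)).2], by linarith [(hb z).2, (hb (s i)).1]⟩

/-- Concentration of the uniform deviation plus the deviation of a single loss `ℓ h₀`. -/
theorem measureReal_le_iSup_sub_add_le (P : Measure Z) [IsProbabilityMeasure P] {ℓ : ι → Z → ℝ}
    (hm : ∀ h, Measurable (ℓ h)) (hb : ∀ h z, ℓ h z ∈ Set.Icc (0 : ℝ) 1) {n : ℕ} (hn : n ≠ 0)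
    (h₀ : ι) {ε : ℝ} (hε : 0 ≤ ε) :
    (Measure.pi fun _ : Fin n => P).real
      {s | (∫ x, ⨆ h, (∫ z, ℓ h z ∂P - (∑ i, ℓ h (x i)) / n) ∂(Measure.pi fun _ : Fin n => P))
          + ε ≤ (⨆ h, (∫ z, ℓ h z ∂P - (∑ i, ℓ h (s i)) / n))
          + ((∑ i, ℓ h₀ (s i)) / n - ∫ z, ℓ h₀ z ∂P)} ≤ Real.exp (-(n * ε ^ 2 / 2)) := by
  have hb' (h z) : |ℓ h z| ≤ 1 := abs_le.2 ⟨by linarith [(hb h z).1], (hb h z).2⟩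
  set μ := Measure.pi fun _ : Fin n => P with hμ
  let avg (h : ι) (s : Fin n → Z) : ℝ := (∑ i, ℓ h (s i)) / n
  let L (h : ι) : ℝ := ∫ z, ℓ h z ∂P
  let D (s : Fin n → Z) : ℝ := ⨆ h, (L h - avg h s)
  have havgm (h : ι) : Measurable (avg h) :=
    (Finset.measurable_sum _ fun i _ => (hm h).comp (measurable_pi_apply i)).div_const _
  have havgb (h : ι) (s) : |avg h s| ≤ 1 := abs_sum_div_le_one fun i => hb' h (s i)
  have hLb (h : ι) : |L h| ≤ 1 := abs_integral_le_of_abs_le (hb' h)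
  have hDm : Measurable D := .iSup fun h => (havgm h).const_sub _
  have hDb (s) : |D s| ≤ 2 := abs_iSup_le_of_abs_le fun h => by
    linarith [abs_sub (L h) (avg h s), havgb h s, hLb h]
  have hDi : Integrable D μ := integrable_of_measurable_of_abs_le hDm hDb
  have havgi : Integrable (avg h₀) μ :=
    integrable_of_measurable_of_abs_le (havgm h₀) (havgb h₀)
  have hEF : ∫ s, (D s + (avg h₀ s - L h₀)) ∂μ = ∫ s, D s ∂μ := by
    rw [integral_add (g := fun s => avg h₀ s - L h₀) hDi (havgi.sub (integrable_const _)),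
      integral_sub havgi (integrable_const _),
      show ∫ s, avg h₀ s ∂μ = L h₀ from integral_sum_div P (hm h₀) (hb' h₀) hn]
    simp
  have hsub := hasSubgaussianMGF_pi_of_update_sub_le P (2 / n) (fun s => D s + (avg h₀ s - L h₀))
    (hDm.add ((havgm h₀).sub_const _)) 4 (fun s => by
      linarith [abs_add_le (D s) (avg h₀ s - L h₀), abs_sub (avg h₀ s) (L h₀), havgb h₀ s,
        hLb h₀, hDb s]) (fun s i z => by
      have h1 : D (Function.update s i z) ≤ D s + 1 / n := ciSup_le fun h => by
        have := le_ciSup (f := fun h => L h - avg h s) (Set.finite_range _).bddAbove h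
        have h2 := abs_sum_update_div_sub_le (hb h) s i z
        dsimp only [D, avg] at this ⊢
        linarith [(abs_le.1 h2).1]
      have h2 : avg h₀ (Function.update s i z) - avg h₀ s ≤ 1 / n :=
        (abs_le.1 (abs_sum_update_div_sub_le (hb h₀) s i z)).2
      have h3 : (((2 / n : ℝ≥0)) : ℝ) = 1 / n + 1 / n := by push_cast; ring
      rw [h3]
      linarith)
  rw [hEF] at hsub
  have := hsub.measure_ge_le hε
  have hn' : (n : ℝ) ≠ 0 := by exact_mod_cast hn
  have hexp : -ε ^ 2 / (2 * ((n * (2 / n / 2) ^ 2 : ℝ≥0) : ℝ)) = -(n * ε ^ 2 / 2) := by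
    push_cast
    field_simp
  rw [hexp] at this
  refine le_trans (measureReal_mono fun s hs => ?_) this
  simp only [Set.mem_ofPred_eq] at hs ⊢
  linarith

end Symmetrization

theorem memCredal.isProbabilityMeasure {Z : Type*} [MeasurableSpace Z] {m : ℕ}
    {Pm : Fin m → Measure Z} (hPm : ∀ j, IsProbabilityMeasure (Pm j)) {P : Measure Z}
    (hP : memCredal Pm P) : IsProbabilityMeasure P := by
  obtain ⟨w, hw, rfl⟩ := hP
  refine ⟨?_⟩
  simp only [Measure.coe_finsetSum, Finset.sum_apply, Measure.smul_apply, measure_univ,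
    smul_eq_mul, mul_one]
  exact_mod_cast hw

theorem abs_sub_le_dTV {Z : Type*} [MeasurableSpace Z] (P Q : Measure Z) [IsProbabilityMeasure P]
    [IsProbabilityMeasure Q] {A : Set Z} (hA : MeasurableSet A) :
    |(P A).toReal - (Q A).toReal| ≤ dTV P Q := by
  refine le_ciSup (f := fun A : {A : Set Z // MeasurableSet A} =>
    |(P A.1).toReal - (Q A.1).toReal|) ⟨1, ?_⟩ ⟨A, hA⟩
  rintro _ ⟨B, rfl⟩
  have h1 := measureReal_le_one (μ := P) (s := B.1)
  have h2 := measureReal_le_one (μ := Q) (s := B.1)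
  rw [measureReal_def] at h1 h2
  exact abs_le.2 ⟨by linarith [(P B.1).toReal_nonneg], by linarith [(Q B.1).toReal_nonneg]⟩

/-- The zero-one loss of `h`, as a function on input-output pairs. -/
noncomputable def zeroOneLoss (h : X → Y) (p : X × Y) : ℝ := if p.2 ≠ h p.1 then 1 else 0

theorem zeroOneLoss_eq_indicator {X Y : Type*} (h : X → Y) :
    zeroOneLoss h = (errSet h).indicator fun _ => 1 := by
  funext p
  by_cases hp : p.2 = h p.1 <;> simp [zeroOneLoss, errSet, Set.indicator, hp]

theorem zeroOneLoss_mem_Icc {X Y : Type*} (h : X → Y) (p : X × Y) :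
    zeroOneLoss h p ∈ Set.Icc (0 : ℝ) 1 := by
  unfold zeroOneLoss
  split_ifs <;> simp

theorem measurable_zeroOneLoss {h : X → Y} (hh : MeasurableSet (errSet h)) :
    Measurable (zeroOneLoss h) := by
  rw [zeroOneLoss_eq_indicator]
  exact measurable_const.indicator hh

theorem integral_zeroOneLoss (P : Measure (X × Y)) {h : X → Y} (hh : MeasurableSet (errSet h)) :
    ∫ p, zeroOneLoss h p ∂P = risk P h := by
  rw [zeroOneLoss_eq_indicator, integral_indicator hh]
  simp [risk, measureReal_def]

theorem empRisk_eq_sum_zeroOneLoss {X Y : Type*} {n : ℕ} (s : Fin n → X × Y) (h : X → Y) :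
    empRisk s h = (∑ i, zeroOneLoss h (s i)) / n := by
  simp [empRisk, zeroOneLoss, Finset.sum_ite]

theorem rademacher_eq_integral_signedSup (n : ℕ) (P : Measure (X × Y)) (H : Finset (X → Y)) :
    rademacher n P H = ∫ p : (Fin n → X × Y) × (Fin n → Bool),
      signedSup (fun h : H => zeroOneLoss (h : X → Y)) p.1 p.2
        ∂((Measure.pi fun _ => P).prod
          (Measure.pi fun _ => (PMF.uniformOfFintype Bool).toMeasure)) :=
  rfl

theorem rademacher_le_one (n : ℕ) (P : Measure (X × Y)) [IsProbabilityMeasure P]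
    {H : Finset (X → Y)} (hH : H.Nonempty) : rademacher n P H ≤ 1 := by
  have := hH.to_subtype
  have hb (p : (Fin n → X × Y) × (Fin n → Bool)) :
      |signedSup (fun h : H => zeroOneLoss (h : X → Y)) p.1 p.2| ≤ 1 :=
    abs_signedSup_le (fun h z => by
      have := zeroOneLoss_mem_Icc (h : X → Y) z
      exact abs_le.2 ⟨by linarith [this.1], this.2⟩) _ _
  rw [rademacher_eq_integral_signedSup]
  exact (abs_le.1 (abs_integral_le_of_abs_le hb)).2

/-- Credal Rademacher bound evaluated at a nearby distribution `Q`. -/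
theorem credal_rademacher_bound_tv {m n : ℕ} (hm : 0 < m) (hn : 1 ≤ n)
    (Pm : Fin m → Measure (X × Y)) (hPm : ∀ j, IsProbabilityMeasure (Pm j))
    (P Q : Measure (X × Y)) [IsProbabilityMeasure P] [IsProbabilityMeasure Q]
    (hP : memCredal Pm P) (hQ : memCredal Pm Q)
    (η : ℝ) (hη : 0 < η) (hTV : dTV P Q ≤ η)
    (H : Finset (X → Y)) (hH : H.Nonempty)
    (hmeas : ∀ h ∈ H, MeasurableSet (errSet h))
    (erm : (Fin n → X × Y) → (X → Y)) (hermM : MeasurableERM erm) (herm : IsERM H erm)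
    (hstar : X → Y) (hstarH : hstar ∈ H) (hstarmin : ∀ h ∈ H, risk P hstar ≤ risk P h)
    (δ : ℝ) (hδ : δ ∈ Set.Ioo (0 : ℝ) 1) :
    (Measure.pi fun _ : Fin n => P)
        {s | risk Q (erm s) - risk P hstar
          ≤ 4 * (⨆ Q' : {Q' : Measure (X × Y) // memCredal Pm Q'}, rademacher n Q'.1 H)
            + Real.sqrt (2 * Real.log (2 / δ) / n) + η}
      ≥ ENNReal.ofReal (1 - δ) := by
  have : Nonempty H := ⟨⟨hstar, hstarH⟩⟩
  have hn0 : n ≠ 0 := by omega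
  let ℓ (h : H) : X × Y → ℝ := zeroOneLoss (h : X → Y)
  have hm' (h : H) : Measurable (ℓ h) := measurable_zeroOneLoss (hmeas h h.2)
  have hb (h : H) (z) : ℓ h z ∈ Set.Icc (0 : ℝ) 1 := zeroOneLoss_mem_Icc _ z
  have hb' (h : H) (z) : |ℓ h z| ≤ 1 := abs_le.2 ⟨by linarith [(hb h z).1], (hb h z).2⟩
  set ε := Real.sqrt (2 * Real.log (2 / δ) / n) with hε
  set μ := Measure.pi fun _ : Fin n => P with hμ
  set E := ∫ s, ⨆ h, (∫ z, ℓ h z ∂P - (∑ i, ℓ h (s i)) / n) ∂μ with hE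
  have hER : E ≤ 2 * rademacher n P H := by
    rw [rademacher_eq_integral_signedSup]
    exact integral_iSup_sub_le_two_mul P hm' hb' hn0
  have hE0 : 0 ≤ E := integral_iSup_sub_nonneg P hm' hb' hn0
  have hRsup : rademacher n P H
      ≤ ⨆ Q' : {Q' : Measure (X × Y) // memCredal Pm Q'}, rademacher n Q'.1 H := by
    refine le_ciSup (f := fun Q' : {Q' : Measure (X × Y) // memCredal Pm Q'} =>
      rademacher n Q'.1 H) ⟨1, ?_⟩ ⟨P, hP⟩
    rintro _ ⟨Q', rfl⟩
    have := memCredal.isProbabilityMeasure hPm Q'.2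
    exact rademacher_le_one n Q'.1 hH
  let F (s : Fin n → X × Y) : ℝ := (⨆ h, (∫ z, ℓ h z ∂P - (∑ i, ℓ h (s i)) / n))
    + ((∑ i, ℓ ⟨hstar, hstarH⟩ (s i)) / n - ∫ z, ℓ ⟨hstar, hstarH⟩ z ∂P)
  have havgm (h : H) : Measurable fun s : Fin n → X × Y => (∑ i, ℓ h (s i)) / n :=
    (Finset.measurable_sum _ fun i _ => (hm' h).comp (measurable_pi_apply i)).div_const _
  have hFm : Measurable F :=
    (Measurable.iSup fun h => (havgm h).const_sub _).add ((havgm _).sub_const _)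
  have htail : μ.real {s | E + ε ≤ F s} ≤ δ := by
    refine (measureReal_le_iSup_sub_add_le P hm' hb hn0 ⟨hstar, hstarH⟩
      (Real.sqrt_nonneg _)).trans ?_
    have hn' : (0 : ℝ) < n := by positivity
    have hlog : 0 ≤ Real.log (2 / δ) :=
      Real.log_nonneg ((one_le_div hδ.1).2 (by linarith [hδ.2]))
    rw [Real.sq_sqrt (by positivity), show -(n * (2 * Real.log (2 / δ) / n) / 2)
      = -Real.log (2 / δ) by field_simp, Real.exp_neg, Real.exp_log (div_pos two_pos hδ.1), inv_div]
    linarith [hδ.1]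
  have hmeasF : MeasurableSet {s | E + ε ≤ F s} := measurableSet_le measurable_const hFm
  refine le_trans ?_ (measure_mono (s := {s | E + ε ≤ F s}ᶜ) fun s hs => ?_)
  · rw [← ofReal_measureReal (measure_ne_top _ _), probReal_compl_eq_one_sub hmeasF]
    exact ENNReal.ofReal_le_ofReal (by linarith)
  · obtain ⟨hermH, hermle⟩ := herm s
    have h1 : -dTV P Q ≤ risk P (erm s) - risk Q (erm s) :=
      (abs_le.1 (abs_sub_le_dTV P Q (hmeas _ hermH))).1
    have h2 := hermle hstar hstarH
    have h3 := le_ciSup (f := fun h => ∫ z, ℓ h z ∂P - (∑ i, ℓ h (s i)) / n)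
      (Set.finite_range _).bddAbove ⟨erm s, hermH⟩
    simp only [Set.mem_compl_iff, Set.mem_ofPred_eq, not_le, F] at hs
    simp only [ℓ] at h3 hs
    rw [integral_zeroOneLoss P (hmeas _ hermH), ← empRisk_eq_sum_zeroOneLoss] at h3
    rw [integral_zeroOneLoss P (hmeas _ hstarH), ← empRisk_eq_sum_zeroOneLoss] at hs
    rw [Set.mem_ofPred_eq]
    linarith
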